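/- Let X be a compact metric space with infinitely many points and α : X → X a homeomorphism such that the set of extreme points of the space of α-invariant Borel probability measures is countable. Then (X, α) has the small-boundary property: for every x ∈ X and every open neighborhood U of x there is an open neighborhood V ⊆ U of x with μ(closure(V) \ V) = 0 for all α-invariant Borel probability measures μ. -/

import Mathlib

open MeasureTheory

namespace SBP

open Set Filter Topology

variable {X : Type*} [MetricSpace X] [CompactSpace X] [MeasurableSpace X] [BorelSpace X]

lemma isClosed_le {K : Set X} (hK : IsClosed K) (y : ENNReal) :
    IsClosed {μ : ProbabilityMeasure X | y ≤ (μ : Measure X) K} := by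
  rw [isClosed_iff_ultrafilter]
  intro μ L hL hmem
  have h := ProbabilityMeasure.limsup_measure_closed_le_of_tendsto (L := (L : Filter _))
    (μs := id) (μ := μ) (tendsto_id.mono_left hL) hK
  refine le_trans ?_ h
  refine le_limsup_of_frequently_le ?_
  exact Eventually.frequently hmem

/-- `T` is a nonempty closed face of `S`. -/
def Face (S T : Set (ProbabilityMeasure X)) : Prop :=
  T.Nonempty ∧ IsClosed T ∧ T ⊆ S ∧
    ∀ μ ∈ T, ∀ ν₁ ∈ S, ∀ ν₂ ∈ S, ∀ a : ENNReal, 0 < a → a < 1 →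
      (μ : Measure X) = a • (ν₁ : Measure X) + (1 - a) • (ν₂ : Measure X) → ν₁ ∈ T ∧ ν₂ ∈ T

lemma ennreal_conv {a p q m : ENNReal} (ha : 0 < a) (ha1 : a < 1) (hm : m ≠ ⊤) (hp : p ≤ m)
    (hq : q ≤ m) (h : m = a * p + (1 - a) * q) : p = m ∧ q = m := by
  have hpt : p ≠ ⊤ := ne_top_of_le_ne_top hm hp
  have hqt : q ≠ ⊤ := ne_top_of_le_ne_top hm hq
  have hat : a ≠ ⊤ := ne_top_of_lt ha1
  lift p to NNReal using hpt
  lift q to NNReal using hqt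
  lift m to NNReal using hm
  lift a to NNReal using hat
  have ha' : a < 1 := by exact_mod_cast ha1
  have ha0 : 0 < a := by exact_mod_cast ha
  have hp' : p ≤ m := by exact_mod_cast hp
  have hq' : q ≤ m := by exact_mod_cast hq
  have h' : m = a * p + (1 - a) * q := by exact_mod_cast h
  have h2 : (m : ℝ) = a * p + (1 - a) * q := by
    have := congrArg NNReal.toReal h'
    simpa [NNReal.coe_sub ha'.le] using this
  have e1 : (0:ℝ) < a := ha0
  have e2 : (a:ℝ) < 1 := ha'
  have e3 : (p:ℝ) ≤ m := hp'
  have e4 : (q:ℝ) ≤ m := hq'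
  have f1 : (p:ℝ) = m := by nlinarith
  have f2 : (q:ℝ) = m := by nlinarith
  constructor
  · exact_mod_cast f1
  · exact_mod_cast f2

lemma Face.max {S T : Set (ProbabilityMeasure X)} (hT : Face S T) {K : Set X}
    (hK : IsClosed K) :
    ∃ μ₀ ∈ T, Face S {μ ∈ T | (μ₀ : Measure X) K ≤ (μ : Measure X) K} ∧
      ∀ μ ∈ T, (μ : Measure X) K ≤ (μ₀ : Measure X) K := by
  obtain ⟨hne, hcl, hsub, hface⟩ := hT
  have husc : UpperSemicontinuous (fun μ : ProbabilityMeasure X => (μ : Measure X) K) := by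
    rw [upperSemicontinuous_iff_isClosed_preimage]
    exact fun y => isClosed_le hK y
  obtain ⟨μ₀, h0, hmax⟩ := UpperSemicontinuousOn.exists_isMaxOn hne hcl.isCompact
    (husc.upperSemicontinuousOn T)
  have hmax' : ∀ μ ∈ T, (μ : Measure X) K ≤ (μ₀ : Measure X) K := fun μ hμ => hmax hμ
  refine ⟨μ₀, h0, ⟨⟨μ₀, h0, le_rfl⟩, hcl.inter (isClosed_le hK _), fun μ h => hsub h.1, ?_⟩, hmax'⟩
  rintro μ ⟨hμ, hle⟩ ν₁ h1 ν₂ h2 a ha ha1 heq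
  obtain ⟨t1, t2⟩ := hface μ hμ ν₁ h1 ν₂ h2 a ha ha1 heq
  have hm : (μ : Measure X) K = (μ₀ : Measure X) K := le_antisymm (hmax' μ hμ) hle
  have h3 : (μ₀ : Measure X) K = a * (ν₁ : Measure X) K + (1 - a) * (ν₂ : Measure X) K := by
    rw [← hm, heq]; simp
  obtain ⟨u1, u2⟩ := ennreal_conv ha ha1 (measure_ne_top _ _) (hmax' _ t1) (hmax' _ t2) h3
  exact ⟨⟨t1, u1.ge⟩, ⟨t2, u2.ge⟩⟩

lemma Face.exists_extreme {S T : Set (ProbabilityMeasure X)} (hT : Face S T) :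
    ∃ μ ∈ T, ∀ ν₁ ∈ S, ∀ ν₂ ∈ S, ∀ a : ENNReal, 0 < a → a < 1 →
      (μ : Measure X) = a • (ν₁ : Measure X) + (1 - a) • (ν₂ : Measure X) → ν₁ = ν₂ := by
  obtain ⟨M, hMT, hM⟩ := zorn_superset_nonempty {T | Face S T} (by
    intro c hc hchain hne
    refine ⟨⋂₀ c, ⟨?_, isClosed_sInter fun t ht => (hc ht).2.1, ?_, ?_⟩,
      fun s hs => sInter_subset_of_mem hs⟩
    · rw [sInter_eq_iInter]
      have := hne.coe_sort
      refine IsCompact.nonempty_iInter_of_directed_nonempty_isCompact_isClosed _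
        (DirectedOn.directed_val (IsChain.directedOn hchain.symm)) ?_ ?_ ?_
      exacts [fun i => (hc i.2).1, fun i => (hc i.2).2.1.isCompact, fun i => (hc i.2).2.1]
    · obtain ⟨t, ht⟩ := hne
      exact (sInter_subset_of_mem ht).trans (hc ht).2.2.1
    · intro μ hμ ν₁ h1 ν₂ h2 a ha ha1 heq
      exact ⟨fun t ht => ((hc ht).2.2.2 μ (hμ t ht) ν₁ h1 ν₂ h2 a ha ha1 heq).1,
        fun t ht => ((hc ht).2.2.2 μ (hμ t ht) ν₁ h1 ν₂ h2 a ha ha1 heq).2⟩) T hT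
  have hMF : Face S M := hM.prop
  have key : ∀ ν₁ ∈ M, ∀ ν₂ ∈ M, ν₁ = ν₂ := by
    intro ν₁ h1 ν₂ h2
    apply Subtype.ext
    change (ν₁ : Measure X) = (ν₂ : Measure X)
    refine ext_of_generate_finite _ (BorelSpace.measurable_eq.trans borel_eq_generateFrom_isClosed)
      isPiSystem_isClosed (fun K hK => ?_) (by simp)
    obtain ⟨μ₀, -, hF, hmax⟩ := hMF.max hK
    have hle := hM.le_of_le hF (fun μ h => h.1)
    exact le_antisymm ((hmax _ h1).trans (hle h2).2) ((hmax _ h2).trans (hle h1).2)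
  obtain ⟨μ, hμ⟩ := hMF.1
  refine ⟨μ, hMT hμ, fun ν₁ h1 ν₂ h2 a ha ha1 heq => ?_⟩
  obtain ⟨t1, t2⟩ := hMF.2.2.2 μ hμ ν₁ h1 ν₂ h2 a ha ha1 heq
  exact key _ t1 _ t2

end SBP

theorem stmt1 {X : Type*} [MetricSpace X] [CompactSpace X] [Infinite X]
    [MeasurableSpace X] [BorelSpace X] (α : X ≃ₜ X)
    (hcount : { μ : Measure X |
      (IsProbabilityMeasure μ ∧ μ.map ⇑α = μ) ∧
      ∀ (ν₁ ν₂ : Measure X) (a : ENNReal),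
        (IsProbabilityMeasure ν₁ ∧ ν₁.map ⇑α = ν₁) →
        (IsProbabilityMeasure ν₂ ∧ ν₂.map ⇑α = ν₂) →
        0 < a → a < 1 → μ = a • ν₁ + (1 - a) • ν₂ → ν₁ = ν₂ }.Countable) :
    ∀ (x : X) (U : Set X), IsOpen U → x ∈ U →
      ∃ V : Set X, IsOpen V ∧ x ∈ V ∧ V ⊆ U ∧
        ∀ μ : Measure X, IsProbabilityMeasure μ → μ.map ⇑α = μ →
          μ (closure V \ V) = 0 := by
  intro x U hU hx
  obtain ⟨ε, hε, hball⟩ := Metric.isOpen_iff.1 hU x hx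
  have hbad := hcount.biUnion (t := fun μ _ => {r : ℝ | 0 < μ (Metric.sphere x r)}) (by
    rintro μ ⟨⟨hp, -⟩, -⟩
    refine Measure.countable_meas_pos_of_disjoint_iUnion
      (fun r => Metric.isClosed_sphere.measurableSet) ?_
    intro r s hrs
    refine Set.disjoint_left.2 fun y hy hy' => hrs ?_
    rw [Metric.mem_sphere] at hy hy'
    exact hy.symm.trans hy')
  have hunc : ¬ (Set.Ioo 0 ε).Countable := by
    intro h
    have := Cardinal.le_aleph0_iff_set_countable.2 h
    rw [Cardinal.mk_Ioo_real hε] at this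
    exact absurd this (not_le.2 Cardinal.aleph0_lt_continuum)
  obtain ⟨r, hr, hrn⟩ := Set.not_subset.1 (fun h => hunc (hbad.mono h))
  refine ⟨Metric.ball x r, Metric.isOpen_ball, Metric.mem_ball_self hr.1,
    (Metric.ball_subset_ball hr.2.le).trans hball, ?_⟩
  have hsub : closure (Metric.ball x r) \ Metric.ball x r ⊆ Metric.sphere x r := by
    rintro y ⟨h1, h2⟩
    have h1' := Metric.closure_ball_subset_closedBall h1
    rw [Metric.mem_closedBall] at h1'
    rw [Metric.mem_ball, not_lt] at h2
    exact le_antisymm h1' h2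
  intro μ hp hinv
  refine measure_mono_null hsub ?_
  let S : Set (ProbabilityMeasure X) := {ν | (ν : Measure X).map α = ν}
  have hSc : IsClosed S := by
    have : S = {ν : ProbabilityMeasure X | ν.map α.continuous.measurable.aemeasurable = ν} := by
      ext ν
      exact (Subtype.ext_iff (a1 := ν.map α.continuous.measurable.aemeasurable) (a2 := ν)).symm
    rw [this]
    exact isClosed_eq (ProbabilityMeasure.continuous_map α.continuous) continuous_id
  have hSF : SBP.Face S S :=
    ⟨⟨⟨μ, hp⟩, hinv⟩, hSc, subset_rfl, fun _ _ _ h1 _ h2 _ _ _ _ => ⟨h1, h2⟩⟩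
  obtain ⟨μ₀, h0, hF, hmax⟩ := hSF.max (K := Metric.sphere x r) Metric.isClosed_sphere
  obtain ⟨e, heT, hext⟩ := hF.exists_extreme
  have he0 : (e : Measure X) (Metric.sphere x r) = 0 := by
    by_contra hne
    apply hrn
    refine Set.mem_biUnion (x := (e : Measure X)) ⟨⟨inferInstance, heT.1⟩, ?_⟩
      (pos_iff_ne_zero.2 hne)
    intro ν₁ ν₂ a h1 h2 ha ha1 heq
    exact congrArg Subtype.val (hext ⟨ν₁, h1.1⟩ h1.2 ⟨ν₂, h2.1⟩ h2.2 a ha ha1 heq)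
  have h3 := (hmax ⟨μ, hp⟩ hinv).trans heT.2
  rw [he0] at h3
  exact le_antisymm h3 zero_le
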